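/- arXiv:2603.28606 — 9 statements merged into one kernel-verified Lean document; each statement's English description precedes it below -/
import Mathlib

section
/- Let a be a real number with 2 < a ≤ 3 and let C = {∑_{n=1}^∞ α_n a^{−n} : α_n ∈ {0,2} for all n ≥ 1} ⊆ ℝ. Then C is a perfect set, i.e., C is closed and has no isolated points. -/
open Filter Topology

lemma norm_digit_div_pow_le {a : ℝ} (ha : 1 < a) {d : ℕ} (hd : d = 0 ∨ d = 2) (n : ℕ) :
    ‖(d : ℝ) / a ^ (n + 1)‖ ≤ 2 / a ^ (n + 1) := by
  have : 0 < a := by linarith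
  rw [Real.norm_of_nonneg (by positivity)]
  gcongr
  rcases hd with rfl | rfl <;> norm_num

lemma tendsto_two_div_pow_succ {a : ℝ} (ha : 1 < a) :
    Tendsto (fun n : ℕ => 2 / a ^ (n + 1)) atTop (𝓝 0) :=
  ((tendsto_pow_atTop_atTop_of_one_lt ha).comp (tendsto_add_atTop_nat 1)).const_div_atTop 2

lemma summable_two_div_pow_succ {a : ℝ} (ha : 1 < a) :
    Summable fun n : ℕ => 2 / a ^ (n + 1) := by
  have h : Summable fun n : ℕ => a⁻¹ ^ n :=
    summable_geometric_of_lt_one (by positivity) (inv_lt_one_of_one_lt₀ ha)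
  simpa [div_eq_mul_inv] using ((summable_nat_add_iff 1).2 h).mul_left 2

lemma summable_digit_div_pow {a : ℝ} (ha : 1 < a) {α : ℕ → ℕ} (hα : ∀ n, α n = 0 ∨ α n = 2) :
    Summable fun n : ℕ => (α n : ℝ) / a ^ (n + 1) :=
  (summable_two_div_pow_succ ha).of_norm_bounded fun n => norm_digit_div_pow_le ha (hα n) n

lemma isCompact_digitExpansions {a : ℝ} (ha : 1 < a) :
    IsCompact {x : ℝ | ∃ α : ℕ → ℕ, (∀ n, α n = 0 ∨ α n = 2) ∧
      x = ∑' n : ℕ, (α n : ℝ) / a ^ (n + 1)} := by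
  have hK : IsCompact {α : ℕ → ℕ | ∀ n, α n ∈ ({0, 2} : Set ℕ)} :=
    isCompact_pi_infinite fun _ => (Set.toFinite _).isCompact
  have hf : ContinuousOn (fun α : ℕ → ℕ => ∑' n : ℕ, (α n : ℝ) / a ^ (n + 1))
      {α : ℕ → ℕ | ∀ n, α n ∈ ({0, 2} : Set ℕ)} :=
    continuousOn_tsum
      (fun n => ((continuous_of_discreteTopology (f := fun k : ℕ => (k : ℝ))).comp
        (continuous_apply n)).div_const _ |>.continuousOn)
      (summable_two_div_pow_succ ha) fun n α hα => norm_digit_div_pow_le ha (hα n) n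
  convert hK.image_of_continuousOn hf using 1
  ext x
  simp [eq_comm]

/-- Replacing one digit by the other one moves the sum by exactly `2 / a ^ (n + 1)`. -/
lemma abs_tsum_flip_digit_sub {a : ℝ} (ha : 1 < a) {α : ℕ → ℕ}
    (hα : ∀ n, α n = 0 ∨ α n = 2) (n : ℕ) :
    ∃ β : ℕ → ℕ, (∀ k, β k = 0 ∨ β k = 2) ∧
      |(∑' k : ℕ, (β k : ℝ) / a ^ (k + 1)) - ∑' k : ℕ, (α k : ℝ) / a ^ (k + 1)| =
        2 / a ^ (n + 1) := by
  have hβ : ∀ k, Function.update α n (2 - α n) k = 0 ∨ Function.update α n (2 - α n) k = 2 := by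
    intro k
    rcases eq_or_ne k n with rfl | hk
    · rw [Function.update_self]
      have := hα k
      lia
    · rw [Function.update_of_ne hk]
      exact hα k
  refine ⟨Function.update α n (2 - α n), hβ, ?_⟩
  rw [← (summable_digit_div_pow ha hβ).tsum_sub (summable_digit_div_pow ha hα),
    tsum_eq_single n fun k hk => by rw [Function.update_of_ne hk, sub_self], Function.update_self]
  have h : 0 < 2 / a ^ (n + 1) := by positivity
  rcases hα n with h0 | h2
  · simpa [h0] using h.le
  · simpa [h2] using h.le

/-- For a real base `a` with `2 < a ≤ 3`, the set
`C = {∑_{n=1}^∞ α_n a^{-n} : α_n ∈ {0,2}}` is a perfect set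
(closed and without isolated points). -/
theorem stmt_0 (a : ℝ) (ha : 2 < a) (ha' : a ≤ 3) :
    Perfect {x : ℝ | ∃ α : ℕ → ℕ, (∀ n, α n = 0 ∨ α n = 2) ∧
      x = ∑' n : ℕ, (α n : ℝ) / a ^ (n + 1)} := by
  have ha1 : 1 < a := by linarith
  refine ⟨(isCompact_digitExpansions ha1).isClosed, preperfect_iff_nhds.2 ?_⟩
  rintro _ ⟨α, hα, rfl⟩ U hU
  obtain ⟨ε, hε, hεU⟩ := Metric.mem_nhds_iff.1 hU
  obtain ⟨n, hn⟩ := ((tendsto_two_div_pow_succ ha1).eventually_lt_const hε).exists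
  obtain ⟨β, hβ, hdist⟩ := abs_tsum_flip_digit_sub ha1 hα n
  refine ⟨_, ⟨hεU ?_, β, hβ, rfl⟩, ?_⟩
  · rwa [Metric.mem_ball, Real.dist_eq, hdist]
  · have : 0 < 2 / a ^ (n + 1) := by positivity
    rw [← hdist] at this
    exact sub_ne_zero.1 (abs_pos.1 this)
end

section
/- Let a be a real number with 2 < a ≤ 3 and let C = {∑_{n=1}^∞ α_n a^{−n} : α_n ∈ {0,2} for all n ≥ 1} ⊆ ℝ. Then C is nowhere dense in ℝ, i.e., the interior of its closure is empty. -/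
open MeasureTheory in
/-- A bounded set of reals `s` with `s ⊆ a⁻¹ s ∪ a⁻¹ (s + b)` for some `a > 2` is nowhere dense. -/
theorem isNowhereDense_of_two_similar_pieces {a b c d : ℝ} (ha : 2 < a) {s : Set ℝ}
    (hs : s ⊆ Set.Icc c d) (h : ∀ x ∈ s, a * x ∈ s ∨ a * x - b ∈ s) : IsNowhereDense s := by
  set D := closure s
  have hfin : volume D ≠ ⊤ :=
    ((measure_mono (closure_minimal hs isClosed_Icc)).trans_lt measure_Icc_lt_top).ne
  have hsub : D ⊆ (a * ·) ⁻¹' D ∪ (a * ·) ⁻¹' ((· - b) ⁻¹' D) := by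
    refine closure_minimal (fun x hx => (h x hx).imp (subset_closure ·) (subset_closure ·)) ?_
    refine (isClosed_closure.preimage (by fun_prop)).union
      ((isClosed_closure.preimage (by fun_prop)).preimage (by fun_prop))
  have ha0 : a ≠ 0 := by positivity
  have hle : volume D ≤ ENNReal.ofReal |a⁻¹| * volume D + ENNReal.ofReal |a⁻¹| * volume D := by
    refine (measure_mono hsub).trans ((measure_union_le _ _).trans_eq ?_)
    rw [Real.volume_preimage_mul_left ha0, Real.volume_preimage_mul_left ha0,
      (measurePreserving_sub_right volume b).measure_preimage isClosed_closure.nullMeasurableSet]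
  have hzero : volume D = 0 := by
    lift volume D to NNReal using hfin with v
    rw [abs_of_pos (by positivity), ENNReal.ofReal] at hle
    norm_cast at hle ⊢
    have hle' : (v : ℝ) ≤ a⁻¹ * v + a⁻¹ * v := by
      have := NNReal.coe_le_coe.mpr hle
      rwa [NNReal.coe_add, NNReal.coe_mul, Real.coe_toNNReal _ (by positivity)] at this
    have hinv : a⁻¹ < 2⁻¹ := inv_strictAnti₀ two_pos ha
    have hv : (v : ℝ) ≤ 0 := by nlinarith [v.coe_nonneg]
    exact le_antisymm (by exact_mod_cast hv) zero_le
  exact Measure.interior_eq_empty_of_null hzero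

/-- For a real base `a` with `2 < a ≤ 3`, the set
`C = {∑_{n=1}^∞ α_n a^{-n} : α_n ∈ {0,2}}` is nowhere dense in ℝ. -/
theorem stmt_1 (a : ℝ) (ha : 2 < a) (ha' : a ≤ 3) :
    IsNowhereDense {x : ℝ | ∃ α : ℕ → ℕ, (∀ n, α n = 0 ∨ α n = 2) ∧
      x = ∑' n : ℕ, (α n : ℝ) / a ^ (n + 1)} := by
  have ha0 : 0 < a := by positivity
  have hbound {α : ℕ → ℕ} (hα : ∀ n, α n = 0 ∨ α n = 2) (n : ℕ) :
      (α n : ℝ) / a ^ (n + 1) ≤ (1 / 2 : ℝ) ^ n := by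
    have h2 : (α n : ℝ) ≤ 2 := by rcases hα n with h | h <;> simp [h]
    calc (α n : ℝ) / a ^ (n + 1) ≤ 2 / 2 ^ (n + 1) := by gcongr
      _ = (1 / 2 : ℝ) ^ n := by rw [pow_succ, one_div, inv_pow]; field_simp
  have hsum {α : ℕ → ℕ} (hα : ∀ n, α n = 0 ∨ α n = 2) :
      Summable fun n : ℕ => (α n : ℝ) / a ^ (n + 1) :=
    Summable.of_nonneg_of_le (fun n => by positivity) (hbound hα) summable_geometric_two
  refine isNowhereDense_of_two_similar_pieces (b := 2) (c := 0) (d := 2) ha ?_ ?_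
  · rintro _ ⟨α, hα, rfl⟩
    exact ⟨tsum_nonneg fun n => by positivity,
      ((hsum hα).tsum_le_tsum (hbound hα) summable_geometric_two).trans_eq tsum_geometric_two⟩
  · rintro _ ⟨α, hα, rfl⟩
    have hshift : a * ∑' n : ℕ, (α n : ℝ) / a ^ (n + 1) =
        α 0 + ∑' n : ℕ, (α (n + 1) : ℝ) / a ^ (n + 1) := by
      rw [(hsum hα).tsum_eq_zero_add, mul_add, ← tsum_mul_left]
      congr 1
      · field_simp
        simp [mul_comm]
      · refine tsum_congr fun n => ?_
        rw [pow_succ a (n + 1)]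
        field_simp
    rcases hα 0 with h | h
    · exact Or.inl ⟨fun n => α (n + 1), fun n => hα _, by simp [hshift, h]⟩
    · exact Or.inr ⟨fun n => α (n + 1), fun n => hα _, by simp [hshift, h]⟩
end

section
/- Let r ≥ 1 be an integer and a a real number with 1 < a ≤ r + 1, and let f : [0,1) → ℝ be defined by f(∑_{n≥1} α_n (r+1)^{−n}) = ∑_{n≥1} α_n a^{−n}, using for each x its base-(r+1) expansion that is not eventually equal to r. Then f is continuous at every point x₀ ∈ (0,1) that is not of the form m/(r+1)^k for positive integers m, k (i.e., at every point having a unique base-(r+1) representation). -/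
/-- The base-`b` digits computed by `Real.digits` are not eventually equal to `b - 1`. -/
theorem Real.not_eventually_digits_eq_last {r : ℕ} (hr : 1 ≤ r) {x : ℝ}
    (hx : x ∈ Set.Ico (0 : ℝ) 1) :
    ¬ ∃ N, ∀ n ≥ N, (Real.digits x (r + 1) n : ℕ) = r := by
  have : NeZero r := ⟨by omega⟩
  rintro ⟨N, hN⟩
  have htail : (fun i ↦ Real.digits x (r + 1) (i + N)) = fun _ ↦ Fin.last r :=
    funext fun i ↦ Fin.ext (hN (i + N) (Nat.le_add_left N i))
  have hsplit := Real.ofDigits_eq_sum_add_ofDigits (Real.digits x (r + 1)) N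
  rw [htail, Real.ofDigits_const_last_eq_one, Real.ofDigits_digits (by omega) hx] at hsplit
  have hsum := Real.ofDigits_digits_sum_eq (b := r + 1) hx N
  have hpow : (((r + 1 : ℕ) : ℝ) ^ N) ≠ 0 := by positivity
  have heq : ((r + 1 : ℕ) : ℝ) ^ N * x = ⌊((r + 1 : ℕ) : ℝ) ^ N * x⌋₊ + 1 := by
    calc ((r + 1 : ℕ) : ℝ) ^ N * x = _ := congrArg _ hsplit
      _ = _ := by rw [mul_add, hsum, mul_one, mul_inv_cancel₀ hpow]
  exact (Nat.lt_floor_add_one (((r + 1 : ℕ) : ℝ) ^ N * x)).ne heq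

/-- A digit is locally constant at a positive point where the corresponding dilate is not a
natural number. -/
theorem Real.eventually_digits_eq {b : ℕ} [NeZero b] {x₀ : ℝ} (h₀ : 0 < x₀) {n : ℕ}
    (h : ∀ m : ℕ, x₀ * (b : ℝ) ^ (n + 1) ≠ m) :
    ∀ᶠ x in nhds x₀, Real.digits x b n = Real.digits x₀ b n := by
  have hpos : 0 ≤ x₀ * (b : ℝ) ^ (n + 1) := by positivity
  have hcont : ContinuousAt (fun x : ℝ ↦ x * (b : ℝ) ^ (n + 1)) x₀ := by fun_prop
  have hlt : (⌊x₀ * (b : ℝ) ^ (n + 1)⌋₊ : ℝ) < x₀ * (b : ℝ) ^ (n + 1) :=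
    (Nat.floor_le hpos).lt_of_ne (h _).symm
  filter_upwards [hcont.eventually_const_lt hlt,
    hcont.eventually_lt_const (Nat.lt_floor_add_one (x₀ * (b : ℝ) ^ (n + 1)))] with x h₁ h₂
  have hfloor : ⌊x * (b : ℝ) ^ (n + 1)⌋₊ = ⌊x₀ * (b : ℝ) ^ (n + 1)⌋₊ :=
    (Nat.floor_eq_iff ((Nat.cast_nonneg _).trans h₁.le)).2 ⟨h₁.le, h₂⟩
  simp only [Real.digits, hfloor]


/-- With `r ≥ 1`, `1 < a ≤ r+1`, and `f : [0,1) → ℝ` defined by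
`f(∑ α_n (r+1)^{-n}) = ∑ α_n a^{-n}` (using the base-(r+1) expansion not eventually
equal to `r`), `f` is continuous at every point of `(0,1)` not of the form
`m/(r+1)^k` with `m, k` positive integers. -/
theorem stmt_3 (r : ℕ) (hr : 1 ≤ r) (a : ℝ) (ha : 1 < a) (ha' : a ≤ r + 1)
    (f : ℝ → ℝ)
    (hf : ∀ α : ℕ → ℕ, (∀ n, α n ≤ r) → (¬ ∃ N, ∀ n ≥ N, α n = r) →
      f (∑' n : ℕ, (α n : ℝ) / ((r : ℝ) + 1) ^ (n + 1)) =
        ∑' n : ℕ, (α n : ℝ) / a ^ (n + 1))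
    (x₀ : ℝ) (hx₀ : x₀ ∈ Set.Ioo (0 : ℝ) 1)
    (hx₀' : ¬ ∃ m k : ℕ, 0 < m ∧ 0 < k ∧ x₀ = (m : ℝ) / ((r : ℝ) + 1) ^ k) :
    ContinuousAt f x₀ := by
  have ha₀ : 0 < a := by linarith
  have hfx : ∀ x ∈ Set.Ico (0 : ℝ) 1,
      f x = ∑' n : ℕ, ((Real.digits x (r + 1) n : ℕ) : ℝ) / a ^ (n + 1) := by
    intro x hx
    have hsum := (Real.hasSum_ofDigitsTerm_digits x (b := r + 1) (by omega) hx).tsum_eq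
    simp only [Real.ofDigitsTerm, ← div_eq_mul_inv, Nat.cast_add, Nat.cast_one] at hsum
    rw [← hf (fun n ↦ (Real.digits x (r + 1) n : ℕ))
      (fun n ↦ Nat.lt_succ_iff.1 (Real.digits x (r + 1) n).isLt)
      (Real.not_eventually_digits_eq_last hr hx), hsum]
  have hIco : ∀ᶠ x in nhds x₀, x ∈ Set.Ico (0 : ℝ) 1 := Ico_mem_nhds hx₀.1 hx₀.2
  have hsummable : Summable fun n : ℕ ↦ (r : ℝ) / a ^ (n + 1) := by
    have hgeom := summable_geometric_of_lt_one (inv_nonneg.2 ha₀.le) (inv_lt_one_of_one_lt₀ ha)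
    simpa only [div_eq_mul_inv, inv_pow] using
      ((summable_nat_add_iff 1).2 hgeom).mul_left (r : ℝ)
  have hlim : Filter.Tendsto
      (fun x ↦ ∑' n : ℕ, ((Real.digits x (r + 1) n : ℕ) : ℝ) / a ^ (n + 1)) (nhds x₀)
      (nhds (∑' n : ℕ, ((Real.digits x₀ (r + 1) n : ℕ) : ℝ) / a ^ (n + 1))) := by
    refine tendsto_tsum_of_dominated_convergence hsummable (fun n ↦ ?_)
      (.of_forall fun x n ↦ ?_)
    · refine tendsto_const_nhds.congr' ?_
      have hne : ∀ m : ℕ, x₀ * ((r + 1 : ℕ) : ℝ) ^ (n + 1) ≠ m := by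
        intro m hm
        push_cast at hm
        have hmpos : (0 : ℝ) < m := by
          rw [← hm]
          exact mul_pos hx₀.1 (by positivity)
        exact hx₀' ⟨m, n + 1, by exact_mod_cast hmpos, n.succ_pos,
          (eq_div_iff (by positivity)).2 hm⟩
      filter_upwards [Real.eventually_digits_eq hx₀.1 hne] with x hx
      rw [hx]
    · rw [Real.norm_of_nonneg (by positivity)]
      gcongr
      exact Nat.lt_succ_iff.1 (Real.digits x (r + 1) n).isLt
  rw [ContinuousAt, hfx x₀ ⟨hx₀.1.le, hx₀.2⟩]
  exact hlim.congr' (hIco.mono fun x hx ↦ (hfx x hx).symm)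
end

section
/- Let r ≥ 1 be an integer and a a real number with 1 < a ≤ r + 1, and let f : [0,1) → ℝ be defined by f(∑_{n≥1} α_n (r+1)^{−n}) = ∑_{n≥1} α_n a^{−n}, using for each x its base-(r+1) expansion that is not eventually equal to r. Then f is continuous at every point of the form m/(r+1)^k ∈ (0,1) (m, k positive integers with m not divisible by r+1) if and only if a = r + 1. -/
open Filter Topology

/-- The digits of a real number in `[0, 1)` are not eventually maximal. -/
theorem digits_not_eventually_last (r : ℕ) (hr : 1 ≤ r) {x : ℝ} (hx : x ∈ Set.Ico (0 : ℝ) 1) :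
    ¬ ∃ N, ∀ n ≥ N, (Real.digits x (r + 1) n : ℕ) = r := by
  rintro ⟨N, hN⟩
  have : NeZero r := ⟨by omega⟩
  have htail : (fun i ↦ Real.digits x (r + 1) (i + N)) = fun _ ↦ Fin.last r := by
    funext i
    exact Fin.ext (hN (i + N) (by omega))
  have hsplit := Real.ofDigits_eq_sum_add_ofDigits (Real.digits x (r + 1)) N
  rw [Real.ofDigits_digits (by omega) hx, htail, Real.ofDigits_const_last_eq_one] at hsplit
  have hsum := Real.ofDigits_digits_sum_eq (b := r + 1) hx N
  have hfloor := Nat.lt_floor_add_one (((r + 1 : ℕ) : ℝ) ^ N * x)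
  have hpos : ((r + 1 : ℕ) : ℝ) ^ N ≠ 0 := by positivity
  rw [← hsum] at hfloor
  nth_rw 1 [hsplit] at hfloor
  rw [mul_add, mul_one, mul_inv_cancel₀ hpos] at hfloor
  exact lt_irrefl _ hfloor

/-- In any base `b > 1`, the expansions `0.0r⋯r` with finitely many digits `r` converge to
`r / (b * (b - 1))`. -/
theorem tendsto_tsum_truncated_const (r : ℕ) {b : ℝ} (hb : 1 < b) :
    Tendsto (fun N ↦ ∑' n : ℕ, ((if n ∈ Finset.Ico 1 N then r else 0 : ℕ) : ℝ) / b ^ (n + 1))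
      atTop (𝓝 (r / (b * (b - 1)))) := by
  have hb0 : b ≠ 0 := by positivity
  have hb1 : b - 1 ≠ 0 := by linarith
  have hgeom : HasSum (fun n : ℕ ↦ (r : ℝ) / b ^ (n + 2)) (r / (b * (b - 1))) := by
    convert! (hasSum_geometric_of_lt_one (r := b⁻¹) (by positivity)
      (inv_lt_one_of_one_lt₀ hb)).mul_left ((r : ℝ) / b ^ 2) using 1
    · funext n
      rw [pow_add, inv_pow]
      field_simp
    · rw [show 1 - b⁻¹ = (b - 1) / b by field_simp, inv_div]
      field_simp
  refine (tendsto_add_atTop_iff_nat 1).1 (hgeom.tendsto_sum_nat.congr fun N ↦ ?_)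
  rw [tsum_eq_sum (s := Finset.Ico 1 (N + 1)) fun n hn ↦ by simp only [if_neg hn]; simp,
    Finset.sum_Ico_eq_sum_range]
  refine Finset.sum_congr (by simp) fun n hn ↦ ?_
  have hn' : n < N := by simpa using hn
  rw [if_pos (by simp; omega), show 1 + n + 1 = n + 2 by ring]

/-- With `r ≥ 1`, `1 < a ≤ r+1`, and `f` as defined via base-(r+1)
expansions not eventually equal to `r`, `f` is continuous at every point of `(0,1)`
of the form `m/(r+1)^k` (with `m, k` positive, `m` not divisible by `r+1`)
if and only if `a = r + 1`. -/
theorem stmt_4 (r : ℕ) (hr : 1 ≤ r) (a : ℝ) (ha : 1 < a) (ha' : a ≤ r + 1)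
    (f : ℝ → ℝ)
    (hf : ∀ α : ℕ → ℕ, (∀ n, α n ≤ r) → (¬ ∃ N, ∀ n ≥ N, α n = r) →
      f (∑' n : ℕ, (α n : ℝ) / ((r : ℝ) + 1) ^ (n + 1)) =
        ∑' n : ℕ, (α n : ℝ) / a ^ (n + 1)) :
    (∀ m k : ℕ, 0 < m → 0 < k → ¬ ((r + 1) ∣ m) →
        (m : ℝ) / ((r : ℝ) + 1) ^ k ∈ Set.Ioo (0 : ℝ) 1 →
        ContinuousAt f ((m : ℝ) / ((r : ℝ) + 1) ^ k)) ↔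
      a = r + 1 := by
  constructor
  · intro h
    have hr0 : (0 : ℝ) < r := by exact_mod_cast hr
    have hcont : ContinuousAt f (1 / ((r : ℝ) + 1)) := by
      have := h 1 1 one_pos one_pos (fun hd ↦ by have := Nat.le_of_dvd one_pos hd; omega)
      simp only [Nat.cast_one, pow_one] at this
      exact this ⟨by positivity, by rw [div_lt_one (by positivity)]; linarith⟩
    have htsum : ∀ b : ℝ,
        ∑' n : ℕ, ((if n = 0 then 1 else 0 : ℕ) : ℝ) / b ^ (n + 1) = 1 / b := by
      intro b
      rw [tsum_eq_single 0 fun n hn ↦ by simp [hn]]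
      simp
    have hval : f (1 / ((r : ℝ) + 1)) = 1 / a := by
      rw [← htsum, ← htsum]
      refine hf _ (fun n ↦ by split_ifs <;> omega) ?_
      rintro ⟨N, hN⟩
      have := hN (N + 1) (by omega)
      simp at this
      omega
    have hleft := tendsto_tsum_truncated_const r (b := (r : ℝ) + 1) (by linarith)
    rw [show (r : ℝ) / ((r + 1) * (r + 1 - 1)) = 1 / (r + 1) by
      rw [add_sub_cancel_right]; field_simp] at hleft
    have hlim := (hcont.tendsto.comp hleft).congr fun N ↦
      hf (fun n ↦ if n ∈ Finset.Ico 1 N then r else 0)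
        (fun n ↦ by split_ifs <;> omega) (by
          rintro ⟨M, hM⟩
          have := hM (M + N) (by omega)
          simp only [Finset.mem_Ico] at this
          rw [if_neg (by omega)] at this
          omega)
    have heq := tendsto_nhds_unique hlim (tendsto_tsum_truncated_const r ha)
    rw [hval] at heq
    have ha1 : a - 1 ≠ 0 := by linarith
    have ha0 : a ≠ 0 := by linarith
    field_simp at heq
    linarith
  · rintro rfl m k _ _ _ hmem
    refine continuousAt_id.congr ?_
    filter_upwards [isOpen_Ioo.mem_nhds hmem] with x hx
    have hx' : x ∈ Set.Ico (0 : ℝ) 1 := ⟨hx.1.le, hx.2⟩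
    have hx_sum : ∑' n : ℕ, ((Real.digits x (r + 1) n : ℕ) : ℝ) / ((r : ℝ) + 1) ^ (n + 1) = x := by
      simpa [Real.ofDigits, Real.ofDigitsTerm, div_eq_mul_inv] using
        Real.ofDigits_digits (b := r + 1) (by omega) hx'
    have hfx := hf (fun n ↦ Real.digits x (r + 1) n)
      (fun n ↦ Nat.lt_succ_iff.1 (Real.digits x (r + 1) n).isLt)
      (digits_not_eventually_last r hr hx')
    rw [hx_sum] at hfx
    exact hfx.symm
end

section
/- Let r ≥ 1 be an integer and a a real number with 1 < a < r + 1, and let f : [0,1) → ℝ be defined by f(∑_{n≥1} α_n (r+1)^{−n}) = ∑_{n≥1} α_n a^{−n}, using for each x its base-(r+1) expansion that is not eventually equal to r. Then f is nowhere monotone: for all u, v with 0 ≤ u < v < 1, f is neither monotone nondecreasing nor monotone nonincreasing on the interval [u, v]. -/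
/-- The defining property of `f` at points whose base-`(r+1)` expansion is finite. -/
lemma apply_finite_expansion {r : ℕ} (hr : 1 ≤ r) {a : ℝ} {f : ℝ → ℝ}
    (hf : ∀ α : ℕ → ℕ, (∀ n, α n ≤ r) → (¬ ∃ N, ∀ n ≥ N, α n = r) →
      f (∑' n : ℕ, (α n : ℝ) / ((r : ℝ) + 1) ^ (n + 1)) =
        ∑' n : ℕ, (α n : ℝ) / a ^ (n + 1))
    (e : ℕ → ℕ) (he : ∀ n, e n ≤ r) (N : ℕ) :
    f (∑ i ∈ Finset.range N, (e i : ℝ) / ((r : ℝ) + 1) ^ (i + 1)) =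
      ∑ i ∈ Finset.range N, (e i : ℝ) / a ^ (i + 1) := by
  have tsum_eq (c : ℝ) : ∑' n : ℕ, (((if n < N then e n else 0 : ℕ) : ℝ)) / c ^ (n + 1) =
      ∑ i ∈ Finset.range N, (e i : ℝ) / c ^ (i + 1) := by
    rw [tsum_eq_sum (s := Finset.range N)]
    · refine Finset.sum_congr rfl fun i hi => ?_
      rw [if_pos (Finset.mem_range.1 hi)]
    · intro i hi
      rw [if_neg (fun h => hi (Finset.mem_range.2 h))]
      simp
  have h := hf (fun n => if n < N then e n else 0)
    (fun n => by split_ifs; exacts [he n, Nat.zero_le r]) (by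
      rintro ⟨M, hM⟩
      have h := hM (max M N) (le_max_left _ _)
      rw [if_neg (by simp)] at h
      omega)
  rwa [tsum_eq, tsum_eq] at h

/-- The digits `d 0, …, d (n-1)`, followed by the digit `p`, followed by `q` forever. -/
def extendDigits (d : ℕ → ℕ) (n p q : ℕ) (i : ℕ) : ℕ :=
  if i < n then d i else if i = n then p else q

lemma extendDigits_le {d : ℕ → ℕ} {r n p q : ℕ} (hd : ∀ i, d i ≤ r) (hp : p ≤ r) (hq : q ≤ r)
    (i : ℕ) : extendDigits d n p q i ≤ r := by
  unfold extendDigits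
  split_ifs
  exacts [hd i, hp, hq]

lemma sum_extendDigits_succ (d : ℕ → ℕ) (n p q : ℕ) (c : ℝ) :
    ∑ i ∈ Finset.range (n + 1), (extendDigits d n p q i : ℝ) / c ^ (i + 1) =
      ∑ i ∈ Finset.range n, (d i : ℝ) / c ^ (i + 1) + p / c ^ (n + 1) := by
  rw [Finset.sum_range_succ]
  congr 1
  · refine Finset.sum_congr rfl fun i hi => ?_
    rw [extendDigits, if_pos (Finset.mem_range.1 hi)]
  · simp [extendDigits]

lemma sum_extendDigits (d : ℕ → ℕ) (n p q m : ℕ) {c : ℝ} (hc : 1 < c) :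
    ∑ i ∈ Finset.range (n + 1 + m), (extendDigits d n p q i : ℝ) / c ^ (i + 1) =
      ∑ i ∈ Finset.range n, (d i : ℝ) / c ^ (i + 1) + p / c ^ (n + 1) +
        q / (c - 1) * (1 / c ^ (n + 1)) * (1 - (1 / c) ^ m) := by
  induction m with
  | zero => simp [sum_extendDigits_succ]
  | succ m ih =>
    have hq : extendDigits d n p q (n + 1 + m) = q := by
      rw [extendDigits, if_neg (by omega), if_neg (by omega)]
    have h0 : c ≠ 0 := by positivity
    have h1 : c - 1 ≠ 0 := by linarith
    rw [← add_assoc, Finset.sum_range_succ, ih, hq, one_div_pow, one_div_pow]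
    field_simp
    ring

/-- Every nondegenerate interval in `[0,1)` contains a full `(r+1)`-adic cylinder. -/
lemma exists_cylinder_subset {r : ℕ} (hr : 1 ≤ r) {u v : ℝ} (hu : 0 ≤ u) (huv : u < v)
    (hv : v < 1) :
    ∃ (d : ℕ → ℕ) (n : ℕ), (∀ i, d i ≤ r) ∧
      u ≤ ∑ i ∈ Finset.range n, (d i : ℝ) / ((r : ℝ) + 1) ^ (i + 1) ∧
      ∑ i ∈ Finset.range n, (d i : ℝ) / ((r : ℝ) + 1) ^ (i + 1) + 1 / ((r : ℝ) + 1) ^ n ≤ v := by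
  have hr' : (1 : ℝ) ≤ r := by exact_mod_cast hr
  obtain ⟨n, hn⟩ := exists_pow_lt_of_lt_one (show 0 < (v - u) / 2 by linarith)
    (show 1 / ((r : ℝ) + 1) < 1 by rw [div_lt_one] <;> linarith)
  have hw : (u + v) / 2 ∈ Set.Ico (0 : ℝ) 1 := ⟨by linarith, by linarith⟩
  have hlow := Real.le_sum_ofDigitsTerm_digits (b := r + 1) hw n
  have hupp := Real.sum_ofDigitsTerm_digits_le (b := r + 1) hw n
  have hsum : ∑ i ∈ Finset.range n,
      Real.ofDigitsTerm (Real.digits ((u + v) / 2) (r + 1)) i =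
      ∑ i ∈ Finset.range n, ((Real.digits ((u + v) / 2) (r + 1) i : ℕ) : ℝ) /
        ((r : ℝ) + 1) ^ (i + 1) := by
    refine Finset.sum_congr rfl fun i _ => ?_
    simp [Real.ofDigitsTerm, div_eq_mul_inv]
  rw [hsum] at hlow hupp
  push_cast at hlow
  rw [one_div_pow] at hn
  have hinv : ((r : ℝ) + 1)⁻¹ ^ n = 1 / ((r : ℝ) + 1) ^ n := by rw [inv_pow, one_div]
  refine ⟨fun i => Real.digits ((u + v) / 2) (r + 1) i, n, fun i => by dsimp only; omega, ?_, ?_⟩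
  · linarith
  · linarith


/-- With `r ≥ 1`, `1 < a < r+1`, and `f` as defined via base-(r+1)
expansions not eventually equal to `r`, `f` is nowhere monotone: on every
nondegenerate closed subinterval `[u,v]` of `[0,1)` it is neither monotone
nondecreasing nor monotone nonincreasing. -/
theorem stmt_5 (r : ℕ) (hr : 1 ≤ r) (a : ℝ) (ha : 1 < a) (ha' : a < r + 1)
    (f : ℝ → ℝ)
    (hf : ∀ α : ℕ → ℕ, (∀ n, α n ≤ r) → (¬ ∃ N, ∀ n ≥ N, α n = r) →
      f (∑' n : ℕ, (α n : ℝ) / ((r : ℝ) + 1) ^ (n + 1)) =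
        ∑' n : ℕ, (α n : ℝ) / a ^ (n + 1)) :
    ∀ u v : ℝ, 0 ≤ u → u < v → v < 1 →
      ¬ MonotoneOn f (Set.Icc u v) ∧ ¬ AntitoneOn f (Set.Icc u v) := by
  intro u v hu huv hv
  have hr' : (1 : ℝ) ≤ r := by exact_mod_cast hr
  obtain ⟨d, n, hd, hud, hdv⟩ := exists_cylinder_subset hr hu huv hv
  have hmono : 1 / ((r : ℝ) + 1) ^ (n + 1) ≤ 1 / ((r : ℝ) + 1) ^ n :=
    one_div_le_one_div_of_le (by positivity) (pow_le_pow_right₀ (by linarith) (by omega))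
  have hb : 0 < 1 / ((r : ℝ) + 1) ^ (n + 1) := by positivity
  have ha0 : 0 < 1 / a ^ (n + 1) := by positivity
  have hfA := apply_finite_expansion hr hf d hd n
  have hfB := apply_finite_expansion hr hf _
    (extendDigits_le (n := n) hd hr (Nat.zero_le r)) (n + 1)
  rw [sum_extendDigits_succ, sum_extendDigits_succ, Nat.cast_one] at hfB
  constructor
  · intro hf_mono
    obtain ⟨m, hm⟩ := exists_pow_lt_of_lt_one
      (show 0 < 1 - (a - 1) / r by rw [sub_pos, div_lt_one] <;> linarith)
      (show 1 / a < 1 by rw [div_lt_one] <;> linarith)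
    have hfC := apply_finite_expansion hr hf _
      (extendDigits_le (n := n) hd (Nat.zero_le r) le_rfl) (n + 1 + m)
    rw [sum_extendDigits _ _ _ _ _ (by linarith), sum_extendDigits _ _ _ _ _ ha, Nat.cast_zero,
      zero_div, zero_div, add_zero, add_zero, add_sub_cancel_right, div_self (by positivity),
      one_mul] at hfC
    have hpow : 0 ≤ (1 / ((r : ℝ) + 1)) ^ m := by positivity
    have hpow' : (1 / ((r : ℝ) + 1)) ^ m ≤ 1 :=
      pow_le_one₀ (by positivity) (by rw [div_le_one] <;> linarith)
    have hC0 := mul_nonneg hb.le (sub_nonneg.2 hpow')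
    have hCB := mul_le_of_le_one_right hb.le (sub_le_self 1 hpow)
    have h := hf_mono ⟨by linarith, by linarith⟩ ⟨by linarith, by linarith⟩
      (add_le_add_right hCB (∑ i ∈ Finset.range n, (d i : ℝ) / ((r : ℝ) + 1) ^ (i + 1)))
    rw [hfB, hfC] at h
    have hgain : 1 < r / (a - 1) * (1 - (1 / a) ^ m) := by
      rw [div_mul_eq_mul_div, one_lt_div (by linarith), ← div_lt_iff₀' (by linarith)]
      linarith
    have := mul_lt_mul_of_pos_left hgain ha0
    linarith
  · intro hf_anti
    have h := hf_anti ⟨hud, by linarith⟩ ⟨by linarith, by linarith⟩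
      (le_add_of_nonneg_right (a := ∑ i ∈ Finset.range n, (d i : ℝ) / ((r : ℝ) + 1) ^ (i + 1))
        hb.le)
    rw [hfA, hfB] at h
    linarith
end

section
/- Let r ≥ 1 be an integer and a a real number with 1 < a < r + 1, and let f : [0,1) → ℝ be defined by f(∑_{n≥1} α_n (r+1)^{−n}) = ∑_{n≥1} α_n a^{−n}, using for each x its base-(r+1) expansion that is not eventually equal to r. Then f has unbounded variation on [0,1): the (extended-real) total variation of f over [0,1) equals +∞. -/
/-- Digit sequences bounded by `r` that are not eventually equal to `r`. -/
def AdmissibleDigits (r : ℕ) (α : ℕ → ℕ) : Prop :=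
  (∀ n, α n ≤ r) ∧ ¬ ∃ N, ∀ n ≥ N, α n = r

/-- Prepend a digit to a digit sequence. -/
def consDigit (d : ℕ) (α : ℕ → ℕ) : ℕ → ℕ
  | 0 => d
  | n + 1 => α n

theorem AdmissibleDigits.cons {r d : ℕ} {α : ℕ → ℕ} (hα : AdmissibleDigits r α) (hd : d ≤ r) :
    AdmissibleDigits r (consDigit d α) := by
  refine ⟨fun n => ?_, ?_⟩
  · cases n with
    | zero => exact hd
    | succ n => exact hα.1 n
  · rintro ⟨N, hN⟩
    exact hα.2 ⟨N, fun n hn => hN (n + 1) (by omega)⟩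

theorem hasSum_const_div_pow_succ {b : ℝ} (hb : 1 < b) (c : ℝ) :
    HasSum (fun n : ℕ => c / b ^ (n + 1)) (c / (b - 1)) := by
  have hb0 : b ≠ 0 := by positivity
  have hb1 : b - 1 ≠ 0 := by linarith
  have h := (hasSum_geometric_of_lt_one (by positivity) (inv_lt_one_of_one_lt₀ hb)).mul_left (c / b)
  have hterm : (fun n : ℕ => c / b ^ (n + 1)) = fun n => c / b * b⁻¹ ^ n := by
    funext n
    rw [inv_pow, pow_succ]
    field_simp
  have hvalue : c / (b - 1) = c / b * (1 - b⁻¹)⁻¹ := by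
    have : 1 - b⁻¹ = (b - 1) / b := by field_simp
    rw [this, inv_div]
    field_simp
  rwa [hterm, hvalue]

theorem summable_digits_div_pow {r : ℕ} {α : ℕ → ℕ} (hα : ∀ n, α n ≤ r) {b : ℝ} (hb : 1 < b) :
    Summable (fun n : ℕ => (α n : ℝ) / b ^ (n + 1)) := by
  refine Summable.of_nonneg_of_le (fun n => by positivity) (fun n => ?_)
    (hasSum_const_div_pow_succ hb (r : ℝ)).summable
  have : (α n : ℝ) ≤ r := by exact_mod_cast hα n
  gcongr

theorem tsum_consDigit {r d : ℕ} {α : ℕ → ℕ} (hα : ∀ n, α n ≤ r) {b : ℝ} (hb : 1 < b) :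
    ∑' n : ℕ, (consDigit d α n : ℝ) / b ^ (n + 1) =
      ((d : ℝ) + ∑' n : ℕ, (α n : ℝ) / b ^ (n + 1)) / b := by
  have hshift : ∀ n : ℕ, (consDigit d α (n + 1) : ℝ) / b ^ (n + 1 + 1) =
      (α n : ℝ) / b ^ (n + 1) / b := fun n => by
    rw [pow_succ b (n + 1), div_div]
    rfl
  rw [(summable_digits_div_pow (r := max d r) (fun n => ?_) hb).tsum_eq_zero_add]
  · simp_rw [hshift]
    rw [tsum_div_const, add_div]
    simp [consDigit]
  · cases n with
    | zero => exact le_max_left d r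
    | succ n => exact (hα n).trans (le_max_right d r)

theorem AdmissibleDigits.tsum_mem_Ico {r : ℕ} (hr : 1 ≤ r) {α : ℕ → ℕ}
    (hα : AdmissibleDigits r α) :
    ∑' n : ℕ, (α n : ℝ) / ((r : ℝ) + 1) ^ (n + 1) ∈ Set.Ico (0 : ℝ) 1 := by
  have hr' : (1 : ℝ) ≤ r := by exact_mod_cast hr
  have hb : (1 : ℝ) < r + 1 := by linarith
  refine ⟨tsum_nonneg fun n => by positivity, ?_⟩
  obtain ⟨n, hn⟩ : ∃ n, α n < r := by
    by_contra! h
    exact hα.2 ⟨0, fun n _ => le_antisymm (hα.1 n) (h n)⟩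
  have hsum := hasSum_const_div_pow_succ hb (r : ℝ)
  have hone : (r : ℝ) / (r + 1 - 1) = 1 := by
    rw [add_sub_cancel_right, div_self (by positivity)]
  rw [hone] at hsum
  refine lt_of_lt_of_eq ?_ hsum.tsum_eq
  refine Summable.tsum_lt_tsum (i := n) (fun k => ?_) ?_
    (summable_digits_div_pow hα.1 hb) hsum.summable
  · have : (α k : ℝ) ≤ r := by exact_mod_cast hα.1 k
    gcongr
  · have : (α n : ℝ) < r := by exact_mod_cast hn
    gcongr

/-- Superadditivity of the variation over finitely many successive sets. -/
theorem eVariationOn_nsmul_le_biUnion (f : ℝ → ℝ) (T : ℕ → Set ℝ) (v : ENNReal)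
    (hT : ∀ i j, i < j → ∀ x ∈ T i, ∀ y ∈ T j, x ≤ y) (n : ℕ)
    (hv : ∀ i < n, v ≤ eVariationOn f (T i)) :
    (n : ENNReal) * v ≤ eVariationOn f (⋃ i < n, T i) := by
  induction n with
  | zero => simp
  | succ n ih =>
    have hadd := eVariationOn.add_le_union f (s := ⋃ i < n, T i) (t := T n) (by
      intro x hx y hy
      simp only [Set.mem_iUnion, exists_prop] at hx
      obtain ⟨i, hi, hx⟩ := hx
      exact hT i n hi x hx y hy)
    rw [Set.biUnion_lt_succ, Nat.cast_succ, add_mul, one_mul]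
    exact (add_le_add (ih fun i hi => hv i (by omega)) (hv n (by omega))).trans hadd

/-- With `r ≥ 1`, `1 < a < r+1`, and `f` as defined via base-(r+1)
expansions not eventually equal to `r`, the total variation of `f` on `[0,1)`
is infinite. -/
theorem stmt_6 (r : ℕ) (hr : 1 ≤ r) (a : ℝ) (ha : 1 < a) (ha' : a < r + 1)
    (f : ℝ → ℝ)
    (hf : ∀ α : ℕ → ℕ, (∀ n, α n ≤ r) → (¬ ∃ N, ∀ n ≥ N, α n = r) →
      f (∑' n : ℕ, (α n : ℝ) / ((r : ℝ) + 1) ^ (n + 1)) =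
        ∑' n : ℕ, (α n : ℝ) / a ^ (n + 1)) :
    eVariationOn f (Set.Ico (0 : ℝ) 1) = ⊤ := by
  have hb : (1 : ℝ) < r + 1 := by linarith
  let S : Set ℝ := {x | ∃ α, AdmissibleDigits r α ∧
    x = ∑' n : ℕ, (α n : ℝ) / ((r : ℝ) + 1) ^ (n + 1)}
  let φ : ℕ → ℝ → ℝ := fun d x => ((d : ℝ) + x) / (r + 1)
  have hS : S ⊆ Set.Ico 0 1 := by
    rintro _ ⟨α, hα, rfl⟩
    exact hα.tsum_mem_Ico hr
  have hφS : ∀ d ≤ r, ∀ x ∈ S, φ d x ∈ S := by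
    rintro d hd _ ⟨α, hα, rfl⟩
    exact ⟨consDigit d α, hα.cons hd, (tsum_consDigit hα.1 hb).symm⟩
  have hfφ : ∀ d ≤ r, ∀ x ∈ S, f (φ d x) = (d + f x) / a := by
    rintro d hd _ ⟨α, hα, rfl⟩
    have hc := hα.cons hd
    have h := hf _ hc.1 hc.2
    rw [tsum_consDigit hα.1 hb, tsum_consDigit hα.1 ha, ← hf _ hα.1 hα.2] at h
    exact h
  have hzero : AdmissibleDigits r fun _ => 0 :=
    ⟨fun _ => Nat.zero_le r, fun ⟨N, hN⟩ => by have : 0 = r := hN N le_rfl; omega⟩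
  have h0S : (0 : ℝ) ∈ S := ⟨_, hzero, by simp⟩
  have hf0 : f 0 = 0 := by simpa using hf _ hzero.1 hzero.2
  have hpos : eVariationOn f S ≠ 0 := by
    have h := eVariationOn.edist_le f h0S (hφS 1 hr 0 h0S)
    rw [hfφ 1 hr 0 h0S, hf0] at h
    intro hV
    rw [hV, nonpos_iff_eq_zero, edist_eq_zero] at h
    have : (0 : ℝ) < ((1 : ℕ) + 0) / a := by positivity
    exact this.ne h
  have hpiece : ∀ d < r + 1,
      eVariationOn f S / ENNReal.ofReal a ≤ eVariationOn f (φ d '' S) := by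
    intro d hd
    have hmono : MonotoneOn (φ d) S := fun x _ y _ hxy => by
      simp only [φ]
      gcongr
    rw [← eVariationOn.comp_eq_of_monotoneOn f (φ d) hmono]
    refine ENNReal.div_le_of_le_mul' ?_
    have hg : LipschitzWith a.toNNReal fun y : ℝ => a * y - d :=
      LipschitzWith.of_dist_le_mul fun x y => by
        rw [Real.coe_toNNReal _ (by positivity), Real.dist_eq, Real.dist_eq,
          sub_sub_sub_cancel_right, ← mul_sub, abs_mul, abs_of_pos (by positivity : 0 < a)]
    refine le_of_eq_of_le (eVariationOn.congr fun x hx => ?_)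
      ((hg.lipschitzOnWith (s := Set.univ)).comp_eVariationOn_le (Set.mapsTo_univ (f ∘ φ d) S))
    simp only [Function.comp, hfφ d (by omega) x hx]
    field_simp
    ring
  have hsep : ∀ i j, i < j → ∀ x ∈ φ i '' S, ∀ y ∈ φ j '' S, x ≤ y := by
    rintro i j hij _ ⟨x, hx, rfl⟩ _ ⟨y, hy, rfl⟩
    have h1 := (hS hx).2
    have h2 := (hS hy).1
    have h3 : (i : ℝ) + 1 ≤ j := by exact_mod_cast hij
    simp only [φ]
    gcongr ?_ / _
    linarith
  have hsuper := (eVariationOn_nsmul_le_biUnion f (fun d => φ d '' S) _ hsep (r + 1) hpiece).trans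
    (eVariationOn.mono f (Set.iUnion₂_subset fun d hd => by
      rintro _ ⟨x, hx, rfl⟩
      exact hφS d (by omega) x hx : _ ⊆ S))
  have htop : eVariationOn f S = ⊤ := by
    by_contra hne
    have ha0 : ENNReal.ofReal a ≠ 0 := by simp; linarith
    have hlt : ENNReal.ofReal a < ((r + 1 : ℕ) : ENNReal) := by
      rw [← ENNReal.ofReal_natCast]
      exact (ENNReal.ofReal_lt_ofReal_iff (by positivity)).2 (by exact_mod_cast ha')
    rw [← mul_div_assoc, ENNReal.div_le_iff ha0 ENNReal.ofReal_ne_top, mul_comm] at hsuper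
    exact absurd hsuper (not_le.2 (ENNReal.mul_lt_mul_right hpos hne hlt))
  exact top_unique (htop ▸ eVariationOn.mono f hS)
end

section
/- Let r = 1 and a = (1 + √5)/2, and let f : [0,1) → ℝ be defined by f(∑_{n≥1} α_n 2^{−n}) = ∑_{n≥1} α_n a^{−n}, using for each x its binary expansion that is not eventually equal to 1. Let y₀ = ∑_{k=0}^∞ a^{−(3k+1)} (the value of the representation with periodic digits (1,0,0)). Then the Hausdorff dimension of the level set {x ∈ [0,1) : f(x) = y₀} is at least 1/3. -/
open scoped ENNReal

open Real
open scoped NNReal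

/-- If `ψ e` depends on `φ e` in a Hölder continuous way, the dimension of the range of `ψ` is
controlled by that of the range of `φ`. -/
theorem dimH_range_le_of_edist_le {ι X Y : Type*} [EMetricSpace X] [EMetricSpace Y]
    {φ : ι → X} {ψ : ι → Y} {C r : ℝ≥0} (hr : 0 < r)
    (h : ∀ e e', edist (ψ e) (ψ e') ≤ C * edist (φ e) (φ e') ^ (r : ℝ)) :
    dimH (Set.range ψ) ≤ dimH (Set.range φ) / r := by
  rcases isEmpty_or_nonempty ι with hι | hι
  · simp [Set.range_eq_empty]
  have key : ∀ e, ψ (Function.invFun φ (φ e)) = ψ e := fun e => by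
    have h1 : φ (Function.invFun φ (φ e)) = φ e := Function.invFun_eq ⟨e, rfl⟩
    have h2 := h (Function.invFun φ (φ e)) e
    rw [h1, edist_self, ENNReal.zero_rpow_of_pos (by exact_mod_cast hr), mul_zero] at h2
    exact edist_le_zero.mp h2
  have hh : HolderOnWith C r (ψ ∘ Function.invFun φ) (Set.range φ) := by
    rintro _ ⟨e, rfl⟩ _ ⟨e', rfl⟩
    simpa only [Function.comp, key] using h e e'
  have := hh.dimH_image_le hr
  rwa [← Set.range_comp, show (ψ ∘ Function.invFun φ) ∘ φ = ψ from funext key] at this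

theorem tsum_eq_tsum_three_mul {F : ℕ → ℝ} (hF : Summable F) :
    ∑' n, F n = ∑' k, (F (3 * k) + F (3 * k + 1) + F (3 * k + 2)) := by
  have hF' : HasSum (fun p : ℕ × Fin 3 => F ((Nat.divModEquiv 3).symm p)) (∑' n, F n) :=
    (Nat.divModEquiv 3).symm.hasSum_iff.mpr hF.hasSum
  refine (HasSum.tsum_eq (hF'.prod_fiberwise fun k => ?_)).symm
  convert hasSum_fintype (fun i : Fin 3 => F ((Nat.divModEquiv 3).symm (k, i))) using 1
  simp [Fin.sum_univ_three, Nat.divModEquiv, mul_comm]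

/-- The binary sequence in which each digit `0` of `ε` becomes the block `1, 0, 0` and each digit
`1` becomes the block `0, 1, 1`. -/
def blockDigits (ε : ℕ → Fin 2) (n : ℕ) : ℕ :=
  if n % 3 = 0 then 1 - ε (n / 3) else ε (n / 3)

theorem blockDigits_three_mul (ε : ℕ → Fin 2) (k : ℕ) :
    blockDigits ε (3 * k) = 1 - ε k := by
  simp [blockDigits]

theorem blockDigits_three_mul_add_one (ε : ℕ → Fin 2) (k : ℕ) :
    blockDigits ε (3 * k + 1) = ε k := by
  simp [blockDigits, show (3 * k + 1) % 3 = 1 by omega, show (3 * k + 1) / 3 = k by omega]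

theorem blockDigits_three_mul_add_two (ε : ℕ → Fin 2) (k : ℕ) :
    blockDigits ε (3 * k + 2) = ε k := by
  simp [blockDigits, show (3 * k + 2) % 3 = 2 by omega, show (3 * k + 2) / 3 = k by omega]

theorem blockDigits_le_one (ε : ℕ → Fin 2) (n : ℕ) : blockDigits ε n ≤ 1 := by
  unfold blockDigits
  have := (ε (n / 3)).isLt
  split_ifs <;> omega

theorem not_eventually_blockDigits_eq_one (ε : ℕ → Fin 2) :
    ¬ ∃ N, ∀ n ≥ N, blockDigits ε n = 1 := by
  rintro ⟨N, hN⟩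
  have h0 := hN (3 * N) (by omega)
  have h1 := hN (3 * N + 1) (by omega)
  rw [blockDigits_three_mul] at h0
  rw [blockDigits_three_mul_add_one] at h1
  omega

theorem tsum_blockDigits_div_pow (ε : ℕ → Fin 2) {b : ℝ} (hb : 1 < b) :
    ∑' n, (blockDigits ε n : ℝ) / b ^ (n + 1) =
      ∑' k, ((1 - (ε k : ℝ)) * b ^ 2 + (ε k : ℝ) * (b + 1)) / b ^ (3 * k + 3) := by
  have hb0 : 0 < b := by linarith
  have hs : Summable fun n => (blockDigits ε n : ℝ) / b ^ (n + 1) := by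
    have hg : Summable fun n : ℕ => b⁻¹ ^ (n + 1) :=
      (summable_nat_add_iff 1).mpr
        (summable_geometric_of_lt_one (by positivity) (inv_lt_one_of_one_lt₀ hb))
    refine Summable.of_nonneg_of_le (fun n => by positivity) (fun n => ?_) hg
    rw [inv_pow, div_eq_mul_inv]
    exact mul_le_of_le_one_left (by positivity) (by exact_mod_cast blockDigits_le_one ε n)
  rw [tsum_eq_tsum_three_mul hs]
  congr 1 with k
  rw [blockDigits_three_mul, blockDigits_three_mul_add_one, blockDigits_three_mul_add_two,
    Nat.cast_sub (by have := (ε k).isLt; omega)]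
  field_simp
  push_cast
  ring

/-- The point whose base `8` digits are `4` and `3` according to the digits `0` and `1` of `ε`;
`4` and `3` are the values of the binary blocks `100` and `011`. -/
noncomputable def blockPoint (ε : ℕ → Fin 2) : ℝ :=
  ofDigits (b := 8) fun k => if ε k = 0 then 4 else 3

theorem tsum_blockDigits_div_two_pow (ε : ℕ → Fin 2) :
    ∑' n, (blockDigits ε n : ℝ) / 2 ^ (n + 1) = blockPoint ε := by
  rw [tsum_blockDigits_div_pow ε one_lt_two, blockPoint, ofDigits]
  congr 1 with k
  rw [ofDigitsTerm, div_eq_mul_inv, show 3 * k + 3 = 3 * (k + 1) by ring, pow_mul]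
  generalize ε k = e
  fin_cases e <;> norm_num

theorem tsum_blockDigits_div_pow_of_sq_eq (ε : ℕ → Fin 2) {a : ℝ} (ha : 1 < a)
    (hsq : a ^ 2 = a + 1) :
    ∑' n, (blockDigits ε n : ℝ) / a ^ (n + 1) = ∑' k : ℕ, 1 / a ^ (3 * k + 1) := by
  have ha0 : a ≠ 0 := by linarith
  rw [tsum_blockDigits_div_pow ε ha]
  congr 1 with k
  rw [← hsq, ← add_mul, sub_add_cancel, one_mul]
  field_simp
  ring

theorem blockPoint_eq_add (ε : ℕ → Fin 2) :
    blockPoint ε = (if ε 0 = 0 then 1 / 2 else 3 / 8) + blockPoint (fun i => ε (i + 1)) / 8 := by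
  rw [blockPoint, ofDigits_eq_sum_add_ofDigits _ 1, ← blockPoint]
  simp only [Finset.sum_range_one, ofDigitsTerm]
  split_ifs <;> norm_num <;> ring

theorem blockPoint_mem_Icc (ε : ℕ → Fin 2) : blockPoint ε ∈ Set.Icc (3 / 8 : ℝ) (5 / 8) := by
  have h0 : 0 ≤ blockPoint fun i => ε (i + 1) := ofDigits_nonneg _
  have h1 : blockPoint (fun i => ε (i + 1)) ≤ 1 := ofDigits_le_one _
  rw [blockPoint_eq_add]
  constructor <;> split_ifs <;> linarith

theorem le_abs_blockPoint_sub_of_ne_zero {ε ε' : ℕ → Fin 2} (h : ε 0 ≠ ε' 0) :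
    3 / 32 ≤ |blockPoint ε - blockPoint ε'| := by
  obtain ⟨h1, h2⟩ := blockPoint_mem_Icc fun i => ε (i + 1)
  obtain ⟨h3, h4⟩ := blockPoint_mem_Icc fun i => ε' (i + 1)
  rw [blockPoint_eq_add ε, blockPoint_eq_add ε', le_abs]
  split_ifs with h5 h6 h6
  · exact absurd (h5.trans h6.symm) h
  · left; linarith
  · right; linarith
  · omega

theorem le_abs_blockPoint_sub {ε ε' : ℕ → Fin 2} {n : ℕ} (heq : ∀ i < n, ε i = ε' i)
    (hne : ε n ≠ ε' n) :
    3 / 32 * ((8 : ℝ) ^ n)⁻¹ ≤ |blockPoint ε - blockPoint ε'| := by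
  have h := le_abs_blockPoint_sub_of_ne_zero (ε := fun i => ε (i + n)) (ε' := fun i => ε' (i + n))
    (by simpa using hne)
  have hsum : ∑ i ∈ Finset.range n, ofDigitsTerm (b := 8) (fun k => if ε k = 0 then 4 else 3) i =
      ∑ i ∈ Finset.range n, ofDigitsTerm (b := 8) (fun k => if ε' k = 0 then 4 else 3) i :=
    Finset.sum_congr rfl fun i hi => by
      simp only [ofDigitsTerm, heq i (Finset.mem_range.mp hi)]
  rw [blockPoint, blockPoint, ofDigits_eq_sum_add_ofDigits _ n,
    ofDigits_eq_sum_add_ofDigits (fun k => if ε' k = 0 then 4 else 3) n, hsum,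
    add_sub_add_left_eq_sub, ← mul_sub, abs_mul, abs_of_nonneg (by positivity), mul_comm]
  exact mul_le_mul_of_nonneg_left h (by positivity)

theorem abs_ofDigits_sub_pow_three_le (ε ε' : ℕ → Fin 2) :
    |ofDigits ε - ofDigits ε'| ^ 3 ≤ 3 ^ 3 * |blockPoint ε - blockPoint ε'| := by
  by_cases h : ε = ε'
  · simp [h]
  have hex : ∃ n, ε n ≠ ε' n := Function.ne_iff.mp h
  have heq : ∀ i < Nat.find hex, ε i = ε' i := fun i hi => not_not.mp (Nat.find_min hex hi)
  have hx := le_abs_blockPoint_sub heq (Nat.find_spec hex)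
  have hy := pow_le_pow_left₀ (abs_nonneg _) (abs_ofDigits_sub_ofDigits_le heq) 3
  have h8 : (((2 : ℕ) : ℝ) ^ Nat.find hex)⁻¹ ^ 3 = ((8 : ℝ) ^ Nat.find hex)⁻¹ := by
    rw [inv_pow, ← pow_mul, mul_comm, pow_mul]
    norm_num
  rw [h8] at hy
  have : 0 < ((8 : ℝ) ^ Nat.find hex)⁻¹ := by positivity
  linarith

theorem edist_ofDigits_le (ε ε' : ℕ → Fin 2) :
    edist (ofDigits ε) (ofDigits ε') ≤
      (3 : ℝ≥0) * edist (blockPoint ε) (blockPoint ε') ^ ((1 / 3 : ℝ≥0) : ℝ) := by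
  have h : dist (ofDigits ε) (ofDigits ε') ≤
      3 * dist (blockPoint ε) (blockPoint ε') ^ (1 / 3 : ℝ) := by
    refine le_of_pow_le_pow_left₀ three_ne_zero (by positivity) ?_
    rw [mul_pow, ← rpow_natCast (_ ^ (1 / 3 : ℝ)), ← rpow_mul dist_nonneg]
    simpa [Real.dist_eq] using abs_ofDigits_sub_pow_three_le ε ε'
  rw [edist_dist, edist_dist, ENNReal.ofReal_rpow_of_nonneg dist_nonneg (by positivity),
    ← ENNReal.ofReal_coe_nnreal, ← ENNReal.ofReal_mul (by positivity)]
  exact ENNReal.ofReal_le_ofReal (by simpa using h)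

theorem one_third_le_dimH_range_blockPoint : (1 / 3 : ℝ≥0∞) ≤ dimH (Set.range blockPoint) := by
  have h1 : (1 : ℝ≥0∞) ≤ dimH (Set.range (ofDigits (b := 2))) := by
    have hsub : Set.Icc (0 : ℝ) 1 ⊆ Set.range (ofDigits (b := 2)) := by
      simpa [Set.SurjOn] using ofDigits_SurjOn one_lt_two
    have hI : dimH (Set.Icc (0 : ℝ) 1) = 1 := by
      rw [Real.dimH_of_nonempty_interior (by simp)]
      simp
    exact hI ▸ dimH_mono hsub
  have h2 := h1.trans (dimH_range_le_of_edist_le (by positivity) edist_ofDigits_le)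
  rw [ENNReal.le_div_iff_mul_le (by simp) (by simp), one_mul] at h2
  simpa using h2

/-- With `r = 1` and `a = (1+√5)/2`, and `f` defined via binary
expansions not eventually equal to `1` by `f(∑ α_n 2^{-n}) = ∑ α_n a^{-n}`,
the level set `f⁻¹(y₀)` with `y₀ = ∑_{k≥0} a^{-(3k+1)}` has Hausdorff dimension
at least `1/3`. -/
theorem stmt_7 (a : ℝ) (ha : a = (1 + Real.sqrt 5) / 2)
    (f : ℝ → ℝ)
    (hf : ∀ α : ℕ → ℕ, (∀ n, α n ≤ 1) → (¬ ∃ N, ∀ n ≥ N, α n = 1) →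
      f (∑' n : ℕ, (α n : ℝ) / 2 ^ (n + 1)) = ∑' n : ℕ, (α n : ℝ) / a ^ (n + 1)) :
    (1 / 3 : ℝ≥0∞) ≤
      dimH {x : ℝ | x ∈ Set.Ico (0 : ℝ) 1 ∧
        f x = ∑' k : ℕ, 1 / a ^ (3 * k + 1)} := by
  refine one_third_le_dimH_range_blockPoint.trans (dimH_mono ?_)
  rintro _ ⟨ε, rfl⟩
  obtain ⟨h0, h1⟩ := blockPoint_mem_Icc ε
  refine ⟨⟨by linarith, by linarith⟩, ?_⟩
  change a = goldenRatio at ha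
  rw [← tsum_blockDigits_div_two_pow,
    hf _ (blockDigits_le_one ε) (not_eventually_blockDigits_eq_one ε)]
  exact tsum_blockDigits_div_pow_of_sq_eq ε (ha ▸ one_lt_goldenRatio) (ha ▸ goldenRatio_sq)
end

section
/- Fix a real a > 1 and an integer r ≥ 1 with a − 1 ≤ r. For any k ≥ 1 and any tuple (c_1,…,c_k) of elements of {0,1,…,r}, the cylinder Δ_{c_1…c_k} equals the closed interval [u, u + d], where u = ∑_{i=1}^k c_i a^{−i} and d = r/(a^k (a−1)). In particular the cylinder has length r/(a^k(a−1)). -/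
/-- The `r_a`-cylinder of rank `k` with base `(c 0, …, c (k-1))`: the set of all
values `∑_{i<k} c_i a^{-(i+1)} + ∑_{n≥k} α_n a^{-(n+1)}` over digit sequences
`α` with values in `{0,…,r}`. -/
def raCylinder (a : ℝ) (r k : ℕ) (c : ℕ → ℕ) : Set ℝ :=
  {x : ℝ | ∃ α : ℕ → ℕ, (∀ n, α n ≤ r) ∧
    x = (∑ i ∈ Finset.range k, (c i : ℝ) / a ^ (i + 1)) +
        ∑' n : ℕ, (α n : ℝ) / a ^ (k + n + 1)}

/-- The remainders of the greedy expansion of `y` in base `a` with digits at most `r`. -/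
noncomputable def greedyRemainder (a : ℝ) (r : ℕ) (y : ℝ) : ℕ → ℝ
  | 0 => y
  | n + 1 => a * greedyRemainder a r y n - (min r ⌊a * greedyRemainder a r y n⌋₊ : ℕ)

/-- One greedy step maps `[0, r / (a - 1)]` into itself. -/
lemma greedy_step_mem_Icc {a : ℝ} (ha : 1 < a) {r : ℕ} (har : a - 1 ≤ r) {t : ℝ}
    (ht : t ∈ Set.Icc 0 ((r : ℝ) / (a - 1))) :
    a * t - (min r ⌊a * t⌋₊ : ℕ) ∈ Set.Icc 0 ((r : ℝ) / (a - 1)) := by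
  have ha' : 0 < a - 1 := sub_pos.2 ha
  have hat : 0 ≤ a * t := mul_nonneg (by linarith) ht.1
  have hfloor := Nat.floor_le hat
  rcases le_total r ⌊a * t⌋₊ with h | h
  · rw [min_eq_left h]
    have hr : (r : ℝ) ≤ ⌊a * t⌋₊ := by exact_mod_cast h
    refine ⟨by linarith, ?_⟩
    have hfix : a * ((r : ℝ) / (a - 1)) - r = r / (a - 1) := by
      field_simp
      ring
    have := mul_le_mul_of_nonneg_left ht.2 (by linarith : 0 ≤ a)
    linarith
  · rw [min_eq_right h]
    have h1 : 1 ≤ (r : ℝ) / (a - 1) := (one_le_div ha').2 har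
    have := Nat.lt_floor_add_one (a * t)
    exact ⟨by linarith, by linarith⟩

lemma greedyRemainder_mem_Icc {a : ℝ} (ha : 1 < a) {r : ℕ} (har : a - 1 ≤ r) {y : ℝ}
    (hy : y ∈ Set.Icc 0 ((r : ℝ) / (a - 1))) (n : ℕ) :
    greedyRemainder a r y n ∈ Set.Icc 0 ((r : ℝ) / (a - 1)) := by
  induction n with
  | zero => exact hy
  | succ n ih => exact greedy_step_mem_Icc ha har ih

/-- Every point of `[0, r / (a - 1)]` has an expansion in base `a` with digits in `{0, …, r}`. -/
lemma exists_digits_hasSum {a : ℝ} (ha : 1 < a) {r : ℕ} (har : a - 1 ≤ r) {y : ℝ}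
    (hy : y ∈ Set.Icc 0 ((r : ℝ) / (a - 1))) :
    ∃ α : ℕ → ℕ, (∀ n, α n ≤ r) ∧ HasSum (fun n => (α n : ℝ) / a ^ (n + 1)) y := by
  have ha0 : 0 < a := by linarith
  refine ⟨fun n => min r ⌊a * greedyRemainder a r y n⌋₊, fun n => min_le_left _ _, ?_⟩
  rw [hasSum_iff_tendsto_nat_of_nonneg (fun n => by positivity)]
  have hsum (N : ℕ) : ∑ n ∈ Finset.range N,
      ((min r ⌊a * greedyRemainder a r y n⌋₊ : ℕ) : ℝ) / a ^ (n + 1) =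
        y - greedyRemainder a r y N / a ^ N := by
    induction N with
    | zero => simp [greedyRemainder]
    | succ N ih =>
      rw [Finset.sum_range_succ, ih, greedyRemainder]
      field_simp
      ring
  simp only [hsum]
  have hlim : Filter.Tendsto (fun N => greedyRemainder a r y N / a ^ N) Filter.atTop (nhds 0) := by
    refine squeeze_zero
      (fun N => div_nonneg (greedyRemainder_mem_Icc ha har hy N).1 (by positivity))
      (fun N => div_le_div_of_nonneg_right (greedyRemainder_mem_Icc ha har hy N).2 (by positivity))
      ?_
    exact (tendsto_pow_atTop_atTop_of_one_lt ha).const_div_atTop _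
  simpa using hlim.const_sub y

/-- The largest digit string has value `r / (a - 1)`. -/
lemma hasSum_const_div_pow {a : ℝ} (ha : 1 < a) (r : ℝ) :
    HasSum (fun n : ℕ => r / a ^ (n + 1)) (r / (a - 1)) := by
  have ha0 : a ≠ 0 := by linarith
  have ha' : a - 1 ≠ 0 := by linarith
  have h := (hasSum_geometric_of_lt_one (inv_nonneg.2 (by linarith))
    (inv_lt_one_of_one_lt₀ ha)).mul_left (r / a)
  have hval : r / a * (1 - a⁻¹)⁻¹ = r / (a - 1) := by
    rw [div_mul_eq_mul_div, div_eq_mul_inv _ a, mul_assoc, ← mul_inv, sub_mul,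
      inv_mul_cancel₀ ha0, one_mul, div_eq_mul_inv]
  rw [hval] at h
  refine h.congr_fun ?_
  intro n
  rw [pow_succ', inv_pow, div_mul_eq_div_div, div_eq_mul_inv _ (a ^ n)]

/-- Digits in `{0, …, r}` in base `a` give a value in `[0, r / (a - 1)]`. -/
lemma tsum_digits_mem_Icc {a : ℝ} (ha : 1 < a) {r : ℕ} {α : ℕ → ℕ} (hα : ∀ n, α n ≤ r) :
    ∑' n : ℕ, (α n : ℝ) / a ^ (n + 1) ∈ Set.Icc 0 ((r : ℝ) / (a - 1)) := by
  have ha0 : 0 < a := by linarith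
  have hr := hasSum_const_div_pow ha r
  have hle (n : ℕ) : (α n : ℝ) / a ^ (n + 1) ≤ r / a ^ (n + 1) :=
    div_le_div_of_nonneg_right (by exact_mod_cast hα n) (by positivity)
  have hs := Summable.of_nonneg_of_le (fun n => by positivity) hle hr.summable
  exact ⟨tsum_nonneg fun n => by positivity, hr.tsum_eq ▸ hs.tsum_le_tsum hle hr.summable⟩

lemma tsum_div_pow_add (a : ℝ) (k : ℕ) (α : ℕ → ℝ) :
    ∑' n : ℕ, α n / a ^ (k + n + 1) = (∑' n : ℕ, α n / a ^ (n + 1)) / a ^ k := by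
  rw [← tsum_div_const]
  refine tsum_congr fun n => ?_
  rw [div_div, ← pow_add, show n + 1 + k = k + n + 1 by ring]

/-- For `a > 1`, integer `r ≥ 1` with `a - 1 ≤ r`, any `k ≥ 1` and
digits `c_1,…,c_k ∈ {0,…,r}`, the cylinder `Δ_{c_1…c_k}` equals the closed interval
`[u, u + r/(a^k (a-1))]` with `u = ∑_{i=1}^k c_i a^{-i}`. -/
theorem stmt_10 (a : ℝ) (ha : 1 < a) (r : ℕ) (hr : 1 ≤ r) (har : a - 1 ≤ r)
    (k : ℕ) (hk : 1 ≤ k) (c : ℕ → ℕ) (hc : ∀ i, i < k → c i ≤ r) :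
    raCylinder a r k c =
      Set.Icc (∑ i ∈ Finset.range k, (c i : ℝ) / a ^ (i + 1))
        ((∑ i ∈ Finset.range k, (c i : ℝ) / a ^ (i + 1)) +
          (r : ℝ) / (a ^ k * (a - 1))) := by
  have hak : 0 < a ^ k := pow_pos (by linarith) k
  have hlen : (r : ℝ) / (a ^ k * (a - 1)) = r / (a - 1) / a ^ k := by
    rw [div_div, mul_comm]
  ext x
  simp only [raCylinder, Set.mem_ofPred_eq, tsum_div_pow_add, hlen]
  set u := ∑ i ∈ Finset.range k, (c i : ℝ) / a ^ (i + 1)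
  constructor
  · rintro ⟨α, hα, rfl⟩
    obtain ⟨h0, h1⟩ := tsum_digits_mem_Icc ha hα
    exact ⟨le_add_of_nonneg_right (div_nonneg h0 hak.le),
      add_le_add_right (div_le_div_of_nonneg_right h1 hak.le) u⟩
  · rintro ⟨h0, h1⟩
    obtain ⟨α, hα, hsum⟩ := exists_digits_hasSum ha har (y := (x - u) * a ^ k)
      ⟨mul_nonneg (sub_nonneg.2 h0) hak.le, (le_div_iff₀ hak).1 (by linarith)⟩
    exact ⟨α, hα, by rw [hsum.tsum_eq, mul_div_cancel_right₀ _ hak.ne']; ring⟩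
end

section
/- Let r = 1 and a = (1 + √5)/2, and let f : [0,1) → ℝ be defined by f(∑_{n≥1} α_n 2^{−n}) = ∑_{n≥1} α_n a^{−n}, using for each x its binary expansion that is not eventually equal to 1. Then for every x in the Cantor-type set C = {∑_{n=1}^∞ d_n 8^{−n} : d_n ∈ {3,4}} one has f(x) = y₀, where y₀ = ∑_{k=0}^∞ a^{−(3k+1)}; that is, C ⊆ f⁻¹({y₀}). -/
/-- A power series in `b⁻¹` with digits `0` and `1`, regrouped in blocks of length three. -/
theorem tsum_div_pow_eq_tsum_blocks {b : ℝ} (hb : 1 < b) {α : ℕ → ℕ} (hα : ∀ n, α n ≤ 1) :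
    ∑' n : ℕ, (α n : ℝ) / b ^ (n + 1) =
      ∑' k : ℕ, ((α (3 * k) : ℝ) * b ^ 2 + α (3 * k + 1) * b + α (3 * k + 2)) /
        (b ^ 3) ^ (k + 1) := by
  have hb0 : 0 < b := by linarith
  have hs : Summable fun n : ℕ => (α n : ℝ) / b ^ (n + 1) := by
    have hgeom : Summable fun n : ℕ => (b⁻¹) ^ (n + 1) :=
      (summable_nat_add_iff 1).2
        (summable_geometric_of_lt_one (by positivity) (inv_lt_one_of_one_lt₀ hb))
    refine hgeom.of_nonneg_of_le (fun n => by positivity) fun n => ?_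
    rw [inv_pow, ← one_div]
    have : (α n : ℝ) ≤ 1 := by exact_mod_cast hα n
    gcongr
  rw [← (Nat.divModEquiv 3).symm.tsum_eq]
  refine ((Nat.divModEquiv 3).symm.summable_iff.2 hs).tsum_prod.trans ?_
  refine tsum_congr fun k => ?_
  simp only [tsum_fintype, Fin.sum_univ_three, Nat.divModEquiv_symm_apply, Function.comp_apply,
    Fin.val_zero, Fin.val_one, Fin.val_two, mul_comm k 3, add_zero]
  rw [← pow_mul]
  field_simp
  ring

/-- The binary digits of a number with base-8 digits `d n ∈ {3, 4}`. -/
def octalBlockDigits (d : ℕ → ℕ) (n : ℕ) : ℕ :=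
  if (d (n / 3) = 4 ↔ n % 3 = 0) then 1 else 0

theorem octalBlockDigits_le_one (d : ℕ → ℕ) (n : ℕ) : octalBlockDigits d n ≤ 1 := by
  unfold octalBlockDigits
  split_ifs <;> simp

theorem octalBlockDigits_three_mul (d : ℕ → ℕ) (k : ℕ) :
    octalBlockDigits d (3 * k) = if d k = 4 then 1 else 0 := by
  simp [octalBlockDigits]

theorem octalBlockDigits_three_mul_add_one (d : ℕ → ℕ) (k : ℕ) :
    octalBlockDigits d (3 * k + 1) = if d k = 4 then 0 else 1 := by
  have h₁ : (3 * k + 1) / 3 = k := by omega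
  have h₂ : (3 * k + 1) % 3 = 1 := by omega
  simp [octalBlockDigits, h₁, h₂]

theorem octalBlockDigits_three_mul_add_two (d : ℕ → ℕ) (k : ℕ) :
    octalBlockDigits d (3 * k + 2) = if d k = 4 then 0 else 1 := by
  have h₁ : (3 * k + 2) / 3 = k := by omega
  have h₂ : (3 * k + 2) % 3 = 2 := by omega
  simp [octalBlockDigits, h₁, h₂]

theorem not_eventually_octalBlockDigits_eq_one (d : ℕ → ℕ) :
    ¬ ∃ N, ∀ n ≥ N, octalBlockDigits d n = 1 := by
  rintro ⟨N, hN⟩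
  have h₀ := hN (3 * N) (by omega)
  have h₁ := hN (3 * N + 1) (by omega)
  rw [octalBlockDigits_three_mul] at h₀
  rw [octalBlockDigits_three_mul_add_one] at h₁
  split_ifs at h₀ h₁

/-- With `r = 1` and `a = (1+√5)/2`, and `f` defined via binary
expansions not eventually equal to `1`, every number whose base-8 expansion uses
only digits 3 and 4 is mapped by `f` to `y₀ = ∑_{k≥0} a^{-(3k+1)}`; that is, the
Cantor-type set `C[8;{3,4}]` is contained in the level set `f⁻¹({y₀})`. -/
theorem stmt_19 (a : ℝ) (ha : a = (1 + Real.sqrt 5) / 2)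
    (f : ℝ → ℝ)
    (hf : ∀ α : ℕ → ℕ, (∀ n, α n ≤ 1) → (¬ ∃ N, ∀ n ≥ N, α n = 1) →
      f (∑' n : ℕ, (α n : ℝ) / 2 ^ (n + 1)) = ∑' n : ℕ, (α n : ℝ) / a ^ (n + 1)) :
    ∀ x ∈ {x : ℝ | ∃ d : ℕ → ℕ, (∀ n, d n = 3 ∨ d n = 4) ∧
        x = ∑' n : ℕ, (d n : ℝ) / 8 ^ (n + 1)},
      f x = ∑' k : ℕ, 1 / a ^ (3 * k + 1) := by
  rintro x ⟨d, hd, rfl⟩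
  have ha₁ : 1 < a := ha ▸ Real.one_lt_goldenRatio
  have ha₂ : a ^ 2 = a + 1 := ha ▸ Real.goldenRatio_sq
  have hx : ∑' n : ℕ, (d n : ℝ) / 8 ^ (n + 1) =
      ∑' n : ℕ, (octalBlockDigits d n : ℝ) / 2 ^ (n + 1) := by
    rw [tsum_div_pow_eq_tsum_blocks one_lt_two (octalBlockDigits_le_one d)]
    refine tsum_congr fun k => ?_
    rw [octalBlockDigits_three_mul, octalBlockDigits_three_mul_add_one,
      octalBlockDigits_three_mul_add_two]
    rcases hd k with h | h <;> norm_num [h]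
  rw [hx, hf _ (octalBlockDigits_le_one d) (not_eventually_octalBlockDigits_eq_one d),
    tsum_div_pow_eq_tsum_blocks ha₁ (octalBlockDigits_le_one d)]
  refine tsum_congr fun k => ?_
  have hblock : (octalBlockDigits d (3 * k) : ℝ) * a ^ 2 + octalBlockDigits d (3 * k + 1) * a +
      octalBlockDigits d (3 * k + 2) = a ^ 2 := by
    rw [octalBlockDigits_three_mul, octalBlockDigits_three_mul_add_one,
      octalBlockDigits_three_mul_add_two]
    rcases hd k with h | h <;> simp [h, ha₂]
  have ha₀ : a ≠ 0 := by positivity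
  rw [hblock, ← pow_mul, div_eq_div_iff (by positivity) (by positivity)]
  ring
end
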